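/- Let α, ρ ∈ ℂ with sin(α/2) ≠ 0, and set A = cot(α/2), V = cosh ρ. Define S = [[cos(α/2), i e^{ρ/2} sin(α/2)], [i e^{−ρ/2} sin(α/2), cos(α/2)]], T = [[cos(α/2), i e^{−ρ/2} sin(α/2)], [i e^{ρ/2} sin(α/2), cos(α/2)]], and W = S⁻¹(STS⁻¹T⁻¹)²(ST⁻¹S⁻¹T)². If P(V, A) = 8V⁵ + 8A²V⁴ + (8A⁴ + 16A² − 8)V³ + (4A⁶ + 8A⁴ − 12A²)V² + (A⁸ + 4A⁶ − 2A⁴ − 12A² + 1)V − 4A⁶ − 8A⁴ + 4A² vanishes, then SWS⁻¹W⁻¹ = I; that is, the assignment s ↦ S, t ↦ T satisfies the defining relation sws⁻¹w⁻¹ = 1 of the fundamental group ⟨s, t | sws⁻¹w⁻¹ = 1⟩, w = s⁻¹[s,t]²[s,t⁻¹]², of the complement of the link 7²₃. -/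

import Mathlib

open Matrix Complex

/-- The square of a `2 × 2` matrix, by the Cayley–Hamilton theorem. -/
theorem sq_fin_two_eq_trace_smul_sub {R : Type*} [CommRing R] (M : Matrix (Fin 2) (Fin 2) R) :
    M ^ 2 = M.trace • M - M.det • (1 : Matrix (Fin 2) (Fin 2) R) := by
  ext i j
  fin_cases i <;> fin_cases j <;>
    simp [pow_two, Matrix.mul_apply, Fin.sum_univ_two, Matrix.trace_fin_two,
      Matrix.det_fin_two] <;> ring

/-- The commutator of the two generators, rescaled to be polynomial in `A`, `x` and `x⁻¹`. -/
noncomputable def scaledComm (A x : ℂ) : Matrix (Fin 2) (Fin 2) ℂ :=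
  !![x ^ 4 - A ^ 2 * x ^ 2 + A ^ 4 + 2 * A ^ 2 + A ^ 2 * x⁻¹ ^ 2,
      A * I * (x ^ 3 + x - x⁻¹ - x⁻¹ ^ 3);
    -(A * I * (x ^ 3 + x - x⁻¹ - x⁻¹ ^ 3)),
      A ^ 2 * x ^ 2 + A ^ 4 + 2 * A ^ 2 - A ^ 2 * x⁻¹ ^ 2 + x⁻¹ ^ 4]

/-- The commutator of the first generator with the inverse of the second, rescaled to be
polynomial in `A`, `x` and `x⁻¹`. -/
noncomputable def scaledCommInv (A x : ℂ) : Matrix (Fin 2) (Fin 2) ℂ :=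
  !![x ^ 4 + A ^ 2 * x ^ 2 + A ^ 4 + 2 * A ^ 2 - A ^ 2 * x⁻¹ ^ 2,
      -(A * I * (x ^ 3 - x - x⁻¹ + x⁻¹ ^ 3));
    -(A * I * (x ^ 3 - x - x⁻¹ + x⁻¹ ^ 3)),
      -(A ^ 2 * x ^ 2) + A ^ 4 + 2 * A ^ 2 + A ^ 2 * x⁻¹ ^ 2 + x⁻¹ ^ 4]

theorem scaledComm_trace (A x : ℂ) :
    (scaledComm A x).trace = x ^ 4 + 2 * A ^ 4 + 4 * A ^ 2 + x⁻¹ ^ 4 := by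
  simp only [scaledComm, Matrix.trace_fin_two_of]
  ring

theorem scaledCommInv_trace (A x : ℂ) :
    (scaledCommInv A x).trace = x ^ 4 + 2 * A ^ 4 + 4 * A ^ 2 + x⁻¹ ^ 4 := by
  simp only [scaledCommInv, Matrix.trace_fin_two_of]
  ring

theorem scaledComm_det (A : ℂ) {x : ℂ} (hx : x ≠ 0) :
    (scaledComm A x).det = (A ^ 2 + 1) ^ 4 := by
  simp only [scaledComm, Matrix.det_fin_two_of]
  field_simp
  ring_nf
  simp only [I_sq]
  ring

theorem scaledCommInv_det (A : ℂ) {x : ℂ} (hx : x ≠ 0) :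
    (scaledCommInv A x).det = (A ^ 2 + 1) ^ 4 := by
  simp only [scaledCommInv, Matrix.det_fin_two_of]
  field_simp
  ring_nf
  simp only [I_sq]
  ring

/-- Commutation with a `2 × 2` matrix whose diagonal is constant. -/
theorem commute_const_diag {R : Type*} [CommRing R] {a b c : R} {M : Matrix (Fin 2) (Fin 2) R}
    (h₁ : M 0 0 = M 1 1) (h₂ : b * M 1 0 = c * M 0 1) :
    Commute !![a, b; c, a] M := by
  rw [commute_iff_eq, Matrix.eta_fin_two M, Matrix.mul_fin_two, Matrix.mul_fin_two, h₁]
  congr! 3 <;> grind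

/-- On the zero locus of the Riley–Mednykh polynomial, the first generator commutes with
`[s,t]²[s,t⁻¹]²`, all matrices being rescaled. -/
theorem commute_scaledComm_sq_mul {A V x : ℂ} (hx : x ≠ 0) (hV : V = (x ^ 2 + x⁻¹ ^ 2) / 2)
    (hP : 8 * V ^ 5 + 8 * A ^ 2 * V ^ 4 + (8 * A ^ 4 + 16 * A ^ 2 - 8) * V ^ 3 +
          (4 * A ^ 6 + 8 * A ^ 4 - 12 * A ^ 2) * V ^ 2 +
          (A ^ 8 + 4 * A ^ 6 - 2 * A ^ 4 - 12 * A ^ 2 + 1) * V -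
          4 * A ^ 6 - 8 * A ^ 4 + 4 * A ^ 2 = 0) :
    Commute !![A, I * x; I * x⁻¹, A] (scaledComm A x ^ 2 * scaledCommInv A x ^ 2) := by
  set τ := x ^ 4 + 2 * A ^ 4 + 4 * A ^ 2 + x⁻¹ ^ 4 with hτ
  set m := (A ^ 2 + 1) ^ 4 with hm
  have key : scaledComm A x ^ 2 * scaledCommInv A x ^ 2 =
      τ • (τ • (scaledComm A x * scaledCommInv A x) - m • (scaledComm A x + scaledCommInv A x)) +
        (m ^ 2) • (1 : Matrix (Fin 2) (Fin 2) ℂ) := by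
    rw [sq_fin_two_eq_trace_smul_sub, sq_fin_two_eq_trace_smul_sub, scaledComm_trace,
      scaledCommInv_trace, scaledComm_det A hx, scaledCommInv_det A hx]
    simp only [sub_mul, mul_sub, smul_mul_assoc, mul_smul_comm, one_mul, mul_one, smul_sub,
      smul_add, smul_smul, ← hτ, ← hm]
    module
  rw [key]
  refine ((commute_const_diag ?_ ?_).smul_right _).add_right ((Commute.one_right _).smul_right _)
  · subst hV
    simp only [scaledComm, scaledCommInv, Matrix.mul_fin_two, Matrix.sub_apply, Matrix.smul_apply,
      Matrix.add_apply, Matrix.of_apply, Matrix.cons_val', Matrix.cons_val_zero,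
      Matrix.cons_val_one, Matrix.cons_val_fin_one, smul_eq_mul, hτ, hm]
    linear_combination (norm := skip) 4 * (x ^ 2 - x⁻¹ ^ 2) * hP
    field_simp
    ring_nf
    simp only [I_sq]
    ring
  · subst hV
    simp only [scaledComm, scaledCommInv, Matrix.mul_fin_two, Matrix.sub_apply, Matrix.smul_apply,
      Matrix.add_apply, Matrix.of_apply, Matrix.cons_val', Matrix.cons_val_zero,
      Matrix.cons_val_one, Matrix.cons_val_fin_one, smul_eq_mul, hτ, hm]
    linear_combination (norm := skip) 4 * A * (x ^ 2 - x⁻¹ ^ 2) * hP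
    field_simp
    ring_nf
    simp only [I_sq]
    ring

/-- Scalars pull out of a product of four matrices. -/
theorem smul_mul_smul_mul_smul_mul_smul {R : Type*} [CommRing R] (s : R)
    (M N M' N' : Matrix (Fin 2) (Fin 2) R) :
    (s • M) * (s • N) * (s • M') * (s • N') = s ^ 4 • (M * N * M' * N') := by
  simp only [smul_mul_assoc, mul_smul_comm, smul_smul]
  ring_nf

/-- The inverse of a determinant-one multiple of a matrix with constant diagonal. -/
theorem inv_smul_const_diag {s a b c : ℂ} (h : (s • !![a, b; c, a]).det = 1) :
    (s • !![a, b; c, a])⁻¹ = s • !![a, -b; -c, a] := by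
  rw [Matrix.inv_def, h, Ring.inverse_one, one_smul]
  simp [Matrix.adjugate_fin_two_of]

theorem scaledComm_eq (A : ℂ) {x : ℂ} (hx : x ≠ 0) :
    !![A, I * x; I * x⁻¹, A] * !![A, I * x⁻¹; I * x, A] * !![A, -(I * x); -(I * x⁻¹), A] *
      !![A, -(I * x⁻¹); -(I * x), A] = scaledComm A x := by
  simp only [scaledComm, Matrix.mul_fin_two]
  ext i j
  fin_cases i <;> fin_cases j <;>
  · simp only [Fin.zero_eta, Fin.mk_one, Matrix.of_apply, Matrix.cons_val', Matrix.cons_val_zero,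
      Matrix.cons_val_one, Matrix.cons_val_fin_one]
    field_simp
    ring_nf
    simp only [I_sq, I_pow_four]
    ring

theorem scaledCommInv_eq (A : ℂ) {x : ℂ} (hx : x ≠ 0) :
    !![A, I * x; I * x⁻¹, A] * !![A, -(I * x⁻¹); -(I * x), A] * !![A, -(I * x); -(I * x⁻¹), A] *
      !![A, I * x⁻¹; I * x, A] = scaledCommInv A x := by
  simp only [scaledCommInv, Matrix.mul_fin_two]
  ext i j
  fin_cases i <;> fin_cases j <;>
  · simp only [Fin.zero_eta, Fin.mk_one, Matrix.of_apply, Matrix.cons_val', Matrix.cons_val_zero,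
      Matrix.cons_val_one, Matrix.cons_val_fin_one]
    field_simp
    ring_nf
    simp only [I_sq, I_pow_four]
    ring

/-- With `S, T` as in the paper and `W = S⁻¹(STS⁻¹T⁻¹)²(ST⁻¹S⁻¹T)²`,
if the Riley–Mednykh polynomial `P(V,A)` of the link 7²₃ vanishes at
`A = cot(α/2)`, `V = cosh ρ`, then `SWS⁻¹W⁻¹ = I`, i.e. `s ↦ S`, `t ↦ T` satisfies
the defining relation of `π₁` of the complement of the link 7²₃. -/
theorem stmt_5 (α ρ : ℂ) (hsin : Complex.sin (α / 2) ≠ 0)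
    (A V : ℂ) (hA : A = Complex.cos (α / 2) / Complex.sin (α / 2)) (hV : V = Complex.cosh ρ)
    (S T W : Matrix (Fin 2) (Fin 2) ℂ)
    (hSdef : S = !![Complex.cos (α / 2), Complex.I * Complex.exp (ρ / 2) * Complex.sin (α / 2);
      Complex.I * Complex.exp (-(ρ / 2)) * Complex.sin (α / 2), Complex.cos (α / 2)])
    (hTdef : T = !![Complex.cos (α / 2), Complex.I * Complex.exp (-(ρ / 2)) * Complex.sin (α / 2);
      Complex.I * Complex.exp (ρ / 2) * Complex.sin (α / 2), Complex.cos (α / 2)])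
    (hWdef : W = S⁻¹ * (S * T * S⁻¹ * T⁻¹) ^ 2 * (S * T⁻¹ * S⁻¹ * T) ^ 2)
    (hP : 8 * V ^ 5 + 8 * A ^ 2 * V ^ 4 + (8 * A ^ 4 + 16 * A ^ 2 - 8) * V ^ 3 +
          (4 * A ^ 6 + 8 * A ^ 4 - 12 * A ^ 2) * V ^ 2 +
          (A ^ 8 + 4 * A ^ 6 - 2 * A ^ 4 - 12 * A ^ 2 + 1) * V -
          4 * A ^ 6 - 8 * A ^ 4 + 4 * A ^ 2 = 0) :
    S * W * S⁻¹ * W⁻¹ = 1 := by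
  set s := Complex.sin (α / 2) with hs
  set x := Complex.exp (ρ / 2) with hx
  have hx0 : x ≠ 0 := Complex.exp_ne_zero _
  have hxinv : Complex.exp (-(ρ / 2)) = x⁻¹ := Complex.exp_neg _
  have hcos : Complex.cos (α / 2) = s * A := by rw [hA]; field_simp
  have hVx : V = (x ^ 2 + x⁻¹ ^ 2) / 2 := by
    rw [hV, Complex.cosh, ← hxinv, hx, ← Complex.exp_nat_mul, ← Complex.exp_nat_mul]
    push_cast
    ring_nf
  have hpyth : s ^ 2 * (A ^ 2 + 1) = 1 := by
    have h := Complex.sin_sq_add_cos_sq (α / 2)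
    rw [hcos, ← hs] at h
    linear_combination h
  have hS : S = s • !![A, I * x; I * x⁻¹, A] := by
    rw [hSdef, hxinv, hcos]
    simp [mul_comm]
  have hT : T = s • !![A, I * x⁻¹; I * x, A] := by
    rw [hTdef, hxinv, hcos]
    simp [mul_comm]
  have hSdet : S.det = 1 := by
    rw [hS, Matrix.det_smul, Matrix.det_fin_two_of, Fintype.card_fin, ← hpyth]
    field_simp
    simp only [I_sq]
    ring
  have hTdet : T.det = 1 := by
    rw [hT, Matrix.det_smul, Matrix.det_fin_two_of, Fintype.card_fin, ← hpyth]
    field_simp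
    simp only [I_sq]
    ring
  have hSinv : S⁻¹ = s • !![A, -(I * x); -(I * x⁻¹), A] := by
    rw [hS] at hSdet ⊢
    exact inv_smul_const_diag hSdet
  have hTinv : T⁻¹ = s • !![A, -(I * x⁻¹); -(I * x), A] := by
    rw [hT] at hTdet ⊢
    exact inv_smul_const_diag hTdet
  have hC : S * T * S⁻¹ * T⁻¹ = s ^ 4 • scaledComm A x := by
    rw [hSinv, hTinv, hS, hT, smul_mul_smul_mul_smul_mul_smul, scaledComm_eq A hx0]
  have hD : S * T⁻¹ * S⁻¹ * T = s ^ 4 • scaledCommInv A x := by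
    rw [hSinv, hTinv, hS, hT, smul_mul_smul_mul_smul_mul_smul, scaledCommInv_eq A hx0]
  have hSK : Commute S ((S * T * S⁻¹ * T⁻¹) ^ 2 * (S * T⁻¹ * S⁻¹ * T) ^ 2) := by
    rw [hC, hD, smul_pow, smul_pow, smul_mul_smul_comm, hS]
    exact ((commute_scaledComm_sq_mul hx0 hVx hP).smul_left _).smul_right _
  have hSunit : IsUnit S.det := by simp [hSdet]
  have hSS : Commute S S⁻¹ := by
    rw [commute_iff_eq, Matrix.mul_nonsing_inv _ hSunit, Matrix.nonsing_inv_mul _ hSunit]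
  have hSW : Commute S W := by
    rw [hWdef, mul_assoc]
    exact hSS.mul_right hSK
  have hWunit : IsUnit W.det := by
    simp [hWdef, Matrix.det_nonsing_inv, hSdet, hTdet]
  rw [hSW.eq, mul_assoc W, Matrix.mul_nonsing_inv _ hSunit, mul_one,
    Matrix.mul_nonsing_inv _ hWunit]
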